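/- arXiv:1811.06739 — 5 statements merged into one kernel-verified Lean document; each statement's English description precedes it below -/
import Mathlib

section
/- Let s_1 ≥ s_2 ≥ … ≥ s_m be real scores with s_1 > s_m defining a monotonic scoring rule. For all integers m > k ≥ 1 and every real number q with 0 < q < 1, the scoring rule satisfies the (q,k,m)-majority criterion if and only if q ≥ ( s_1 − (1/k)·Σ_{i=1}^{k} s_{m−i+1} ) / ( s_1 − (1/k)·Σ_{i=1}^{k} s_{m−i+1} + (1/k)·Σ_{i=1}^{k} s_i − s_{k+1} ). -/
open Finset
open scoped Classical

noncomputable section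

/-- A preference profile: each of the `n` voters has a ranking of the `m`
candidates, given as a bijection sending each candidate to its rank
(rank `0` is the best).  Voter `i` prefers `a` to `b` iff `P i a < P i b`. -/
abbrev Profile (m n : ℕ) := Fin n → (Fin m ≃ Fin m)

namespace Voting

variable {m n : ℕ}

/-- `h(a,b)`: the number of voters who prefer candidate `a` to candidate `b`. -/
def pairs (P : Profile m n) (a b : Fin m) : ℕ :=
  (Finset.univ.filter fun i => P i a < P i b).card

/-- `n_1(a)`: the number of voters who rank candidate `a` first. -/
def firstCount (P : Profile m n) (a : Fin m) : ℕ :=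
  (Finset.univ.filter fun i => ∀ b, b ≠ a → P i a < P i b).card

/-- `n_m(a)`: the number of voters who rank candidate `a` last. -/
def lastCount (P : Profile m n) (a : Fin m) : ℕ :=
  (Finset.univ.filter fun i => ∀ b, b ≠ a → P i b < P i a).card

/-- The number of voters who give the set `B` the top `|B|` positions. -/
def topSupporters (P : Profile m n) (B : Finset (Fin m)) : ℕ :=
  (Finset.univ.filter fun i => ∀ a ∈ B, ∀ b ∉ B, P i a < P i b).card

/-- The `(q,k,m)`-majority criterion for a voting rule with `m` candidates:
for every number of voters `n ≥ 1`, every profile, and every `k`-element set `B`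
of candidates such that strictly more than `q·n` voters give `B` the top `k`
positions, every winner belongs to `B`. -/
def MajorityCriterion (m k : ℕ) (q : ℝ)
    (rule : (n : ℕ) → Profile m n → Finset (Fin m)) : Prop :=
  ∀ n : ℕ, 1 ≤ n → ∀ P : Profile m n, ∀ B : Finset (Fin m),
    B.card = k → q * (n : ℝ) < (topSupporters P B : ℝ) → rule n P ⊆ B

/-- The total score of candidate `a` under the scoring vector `s`
(`s j` is the score for rank `j`). -/
def totalScore (P : Profile m n) (s : Fin m → ℝ) (a : Fin m) : ℝ :=
  ∑ i, s (P i a)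

/-- The scoring rule with scores `s`: winners have the highest total score. -/
def scoringWinners (P : Profile m n) (s : Fin m → ℝ) : Finset (Fin m) :=
  Finset.univ.filter fun a => ∀ b, totalScore P s b ≤ totalScore P s a

theorem sub_one_sub_lt {m k : ℕ} (hmk : k < m) (i : ℕ) : m - 1 - i < m := by
  omega

/-- Any `k` ranks have total score at least that of the `k` bottom ranks. -/
theorem sum_bottom_le {m k : ℕ} (hmk : k < m) (s : Fin m → ℝ) (hmono : Antitone s)
    (C : Finset (Fin m)) (hC : C.card = k) :
    ∑ i : Fin k, s ⟨m - 1 - (i : ℕ), sub_one_sub_lt hmk i⟩ ≤ ∑ c ∈ C, s c := by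
  set f := C.orderEmbOfFin hC
  have hf : ∀ (j : ℕ) (hj : j < k), (f (Fin.rev ⟨j, hj⟩) : ℕ) ≤ m - 1 - j := by
    intro j
    induction j with
    | zero => intro hj; omega
    | succ j ih =>
      intro hj
      have h₁ := ih (by omega)
      have h₂ : f (Fin.rev ⟨j + 1, hj⟩) < f (Fin.rev ⟨j, by omega⟩) := by
        rw [f.lt_iff_lt, Fin.rev_lt_rev, Fin.mk_lt_mk]
        omega
      rw [Fin.lt_def] at h₂
      omega
  have hsum : ∑ c ∈ C, s c = ∑ i : Fin k, s (f (Fin.rev i)) := by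
    rw [show ∑ i : Fin k, s (f (Fin.rev i)) = ∑ i, s (f i) from
      Equiv.sum_comp Fin.revPerm fun i => s (f i), ← C.image_orderEmbOfFin_univ hC,
      Finset.sum_image f.injective.injOn]
  rw [hsum]
  exact Finset.sum_le_sum fun i _ => hmono (Fin.le_def.2 (hf i i.2))

/-- A candidate outside a set of `k` top candidates has rank index at least `k`. -/
theorem card_le_rank {m : ℕ} (p : Fin m ≃ Fin m) (B : Finset (Fin m))
    (hp : ∀ a ∈ B, ∀ b ∉ B, p a < p b) {a : Fin m} (ha : a ∉ B) : B.card ≤ (p a : ℕ) := by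
  rw [← Fin.card_Iio, ← Finset.card_map p.toEmbedding]
  refine Finset.card_le_card fun x hx => ?_
  obtain ⟨b, hb, rfl⟩ := Finset.mem_map.1 hx
  exact Finset.mem_Iio.2 (hp b hb a ha)

/-- A candidate in a set of `k` top candidates has rank index less than `k`. -/
theorem rank_lt_card {m : ℕ} (p : Fin m ≃ Fin m) (B : Finset (Fin m))
    (hp : ∀ a ∈ B, ∀ b ∉ B, p a < p b) {a : Fin m} (ha : a ∈ B) : (p a : ℕ) < B.card := by
  have h : (Bᶜ).card ≤ (Finset.Ioi (p a)).card := by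
    rw [← Finset.card_map p.toEmbedding]
    refine Finset.card_le_card fun x hx => ?_
    obtain ⟨b, hb, rfl⟩ := Finset.mem_map.1 hx
    exact Finset.mem_Ioi.2 (hp a ha b (Finset.mem_compl.1 hb))
  rw [Finset.card_compl, Fin.card_Ioi, Fintype.card_fin] at h
  have := (p a).2
  omega

/-- A voter giving `B` the top positions gives `B` the sum of the top scores. -/
theorem sum_score_of_top {m k : ℕ} (hmk : k < m) (s : Fin m → ℝ) (p : Fin m ≃ Fin m)
    (B : Finset (Fin m)) (hB : B.card = k) (hp : ∀ a ∈ B, ∀ b ∉ B, p a < p b) :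
    ∑ b ∈ B, s (p b) = ∑ i : Fin k, s ⟨(i : ℕ), i.2.trans hmk⟩ := by
  have hinj : Function.Injective fun i : Fin k => (⟨(i : ℕ), i.2.trans hmk⟩ : Fin m) := by
    intro i j h
    simpa [Fin.ext_iff] using h
  have himage : B.image p =
      Finset.univ.image fun i : Fin k => (⟨(i : ℕ), i.2.trans hmk⟩ : Fin m) := by
    refine Finset.eq_of_subset_of_card_le (fun x hx => ?_) ?_
    · obtain ⟨b, hb, rfl⟩ := Finset.mem_image.1 hx
      exact Finset.mem_image.2 ⟨⟨p b, hB ▸ rank_lt_card p B hp hb⟩, Finset.mem_univ _, rfl⟩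
    · rw [Finset.card_image_of_injective _ hinj, Finset.card_image_of_injective _ p.injective]
      simp [hB]
  rw [← Finset.sum_image (f := s) p.injective.injOn, himage, Finset.sum_image hinj.injOn]

/-- A sum over voters of a two-valued function. -/
theorem sum_ite_const {n : ℕ} (p : Fin n → Prop) [DecidablePred p] (x y : ℝ) :
    ∑ i, (if p i then x else y) =
      ((Finset.univ.filter p).card : ℝ) * x + (n - (Finset.univ.filter p).card) * y := by
  have h := Finset.card_filter_add_card_filter_not (s := (Finset.univ : Finset (Fin n))) p
  rw [Finset.card_univ, Fintype.card_fin] at h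
  rw [Finset.sum_ite, Finset.sum_const, Finset.sum_const, nsmul_eq_mul, nsmul_eq_mul]
  have h' : ((Finset.univ.filter p).card : ℝ) + (Finset.univ.filter fun i => ¬ p i).card = n := by
    exact_mod_cast h
  rw [← h', add_sub_cancel_left]

/-- If a candidate outside the `k`-set `B` wins, the supporters of `B` are few. -/
theorem topSupporters_mul_le {m k n : ℕ} (hk : 1 ≤ k) (hmk : k < m) (s : Fin m → ℝ)
    (hmono : Antitone s) (P : Profile m n) (B : Finset (Fin m)) (hB : B.card = k)
    {a : Fin m} (ha : a ∈ scoringWinners P s) (haB : a ∉ B) :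
    (topSupporters P B : ℝ) * ∑ i : Fin k, s ⟨(i : ℕ), i.2.trans hmk⟩ +
        (n - topSupporters P B) * ∑ i : Fin k, s ⟨m - 1 - (i : ℕ), sub_one_sub_lt hmk i⟩ ≤
      k * (topSupporters P B * s ⟨k, hmk⟩ + (n - topSupporters P B) * s ⟨0, k.zero_le.trans_lt hmk⟩) := by
  have hwin : ∀ b, totalScore P s b ≤ totalScore P s a := (Finset.mem_filter.1 ha).2
  calc
    _ = ∑ i, (if ∀ a ∈ B, ∀ b ∉ B, P i a < P i b then ∑ i : Fin k, s ⟨(i : ℕ), i.2.trans hmk⟩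
          else ∑ i : Fin k, s ⟨m - 1 - (i : ℕ), sub_one_sub_lt hmk i⟩) := (sum_ite_const _ _ _).symm
    _ ≤ ∑ i, ∑ b ∈ B, s (P i b) := by
      refine Finset.sum_le_sum fun i _ => ?_
      split_ifs with h
      · exact (sum_score_of_top hmk s (P i) B hB h).ge
      · have := sum_bottom_le hmk s hmono (B.map (P i).toEmbedding) (by simpa using hB)
        simpa using this
    _ = ∑ b ∈ B, totalScore P s b := Finset.sum_comm
    _ ≤ k * totalScore P s a := by
      rw [← nsmul_eq_mul, ← hB]
      exact Finset.sum_le_card_nsmul _ _ _ fun b _ => hwin b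
    _ ≤ k * ∑ i, (if ∀ a ∈ B, ∀ b ∉ B, P i a < P i b then s ⟨k, hmk⟩
          else s ⟨0, k.zero_le.trans_lt hmk⟩) := by
      refine mul_le_mul_of_nonneg_left (Finset.sum_le_sum fun i _ => ?_) (Nat.cast_nonneg k)
      split_ifs with h
      · exact hmono (Fin.le_def.2 (hB ▸ card_le_rank (P i) B h haB))
      · exact hmono (Fin.le_def.2 (Nat.zero_le _))
    _ = _ := by rw [sum_ite_const, topSupporters]

/-- The ranking with the first `k` candidates on top, permuted by `σ`. -/
def topRanking {m k : ℕ} (hmk : k < m) (σ : Equiv.Perm (Fin k)) : Fin m ≃ Fin m :=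
  Equiv.ofBijective
    (fun x => if h : (x : ℕ) < k then ⟨σ ⟨x, h⟩, (σ ⟨x, h⟩).2.trans hmk⟩ else x) <| by
    refine Finite.injective_iff_bijective.1 fun x y hxy => ?_
    split_ifs at hxy with hx hy hy
    · have := σ.injective (Fin.ext (Fin.mk.inj hxy))
      exact Fin.ext (Fin.mk.inj this)
    · have : (σ ⟨x, hx⟩ : ℕ) = y := Fin.val_eq_of_eq hxy
      have := (σ ⟨x, hx⟩).2
      omega
    · have : (x : ℕ) = σ ⟨y, hy⟩ := Fin.val_eq_of_eq hxy
      have := (σ ⟨y, hy⟩).2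
      omega
    · exact hxy

/-- The ranking with the first `k` candidates at the bottom, permuted by `σ`. -/
def bottomRanking {m k : ℕ} (hmk : k < m) (σ : Equiv.Perm (Fin k)) : Fin m ≃ Fin m :=
  Equiv.ofBijective
    (fun x => if h : (x : ℕ) < k then ⟨m - 1 - σ ⟨x, h⟩, by omega⟩ else ⟨x - k, by omega⟩) <| by
    refine Finite.injective_iff_bijective.1 fun x y hxy => ?_
    split_ifs at hxy with hx hy hy <;> have h := Fin.mk.inj hxy
    · have := σ.injective (Fin.ext (by omega) : σ ⟨x, hx⟩ = σ ⟨y, hy⟩)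
      exact Fin.ext (Fin.mk.inj this)
    · omega
    · omega
    · exact Fin.ext (by omega)

theorem topRanking_of_lt {m k : ℕ} (hmk : k < m) (σ : Equiv.Perm (Fin k)) {x : Fin m}
    (h : (x : ℕ) < k) : topRanking hmk σ x = ⟨σ ⟨x, h⟩, by omega⟩ := by
  simp [topRanking, h]

theorem topRanking_of_le {m k : ℕ} (hmk : k < m) (σ : Equiv.Perm (Fin k)) {x : Fin m}
    (h : k ≤ (x : ℕ)) : topRanking hmk σ x = x := by
  simp [topRanking, h.not_gt]

theorem bottomRanking_of_lt {m k : ℕ} (hmk : k < m) (σ : Equiv.Perm (Fin k)) {x : Fin m}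
    (h : (x : ℕ) < k) : bottomRanking hmk σ x = ⟨m - 1 - σ ⟨x, h⟩, by omega⟩ := by
  simp [bottomRanking, h]

theorem bottomRanking_of_le {m k : ℕ} (hmk : k < m) (σ : Equiv.Perm (Fin k)) {x : Fin m}
    (h : k ≤ (x : ℕ)) : bottomRanking hmk σ x = ⟨x - k, by omega⟩ := by
  simp [bottomRanking, h.not_gt]

/-- A profile in which, for each rotation `j`, `T` voters rank the first `k` candidates on top
and `M` voters rank them at the bottom. -/
def rotationProfile {m k : ℕ} [NeZero k] (hmk : k < m) (T M : ℕ) : Profile m (k * (T + M)) := fun i =>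
  let v := Fintype.equivOfCardEq
    (by simp : Fintype.card (Fin (k * (T + M))) = Fintype.card (Fin k × (Fin T ⊕ Fin M))) i
  Sum.elim (fun _ => topRanking hmk (Equiv.addRight v.1))
    (fun _ => bottomRanking hmk (Equiv.addRight v.1)) v.2

theorem sum_rotationProfile {m k : ℕ} [NeZero k] (hmk : k < m) (T M : ℕ) (F : (Fin m ≃ Fin m) → ℝ) :
    ∑ i, F (rotationProfile hmk T M i) =
      T * ∑ j, F (topRanking hmk (Equiv.addRight j)) +
        M * ∑ j, F (bottomRanking hmk (Equiv.addRight j)) := by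
  simp only [rotationProfile]
  rw [Equiv.sum_comp (Fintype.equivOfCardEq _) fun v : Fin k × (Fin T ⊕ Fin M) =>
    F (Sum.elim (fun _ => topRanking hmk (Equiv.addRight v.1))
      (fun _ => bottomRanking hmk (Equiv.addRight v.1)) v.2)]
  simp [Fintype.sum_prod_type, Finset.sum_add_distrib, Finset.mul_sum]

theorem totalScore_rotationProfile_of_lt {m k : ℕ} [NeZero k] (hmk : k < m) (T M : ℕ) (s : Fin m → ℝ)
    {x : Fin m} (h : (x : ℕ) < k) :
    totalScore (rotationProfile hmk T M) s x =
      T * ∑ i : Fin k, s ⟨(i : ℕ), i.2.trans hmk⟩ +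
        M * ∑ i : Fin k, s ⟨m - 1 - (i : ℕ), sub_one_sub_lt hmk i⟩ := by
  rw [totalScore, sum_rotationProfile hmk T M fun p => s (p x)]
  simp only [topRanking_of_lt hmk _ h, bottomRanking_of_lt hmk _ h]
  congr 2
  · exact Equiv.sum_comp (Equiv.addLeft (⟨x, h⟩ : Fin k))
      fun i => s ⟨(i : ℕ), i.2.trans hmk⟩
  · exact Equiv.sum_comp (Equiv.addLeft (⟨x, h⟩ : Fin k))
      fun i => s ⟨m - 1 - (i : ℕ), sub_one_sub_lt hmk i⟩

theorem totalScore_rotationProfile_of_le {m k : ℕ} [NeZero k] (hmk : k < m) (T M : ℕ) (s : Fin m → ℝ)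
    {x : Fin m} (h : k ≤ (x : ℕ)) :
    totalScore (rotationProfile hmk T M) s x =
      k * (T * s x + M * s ⟨x - k, by omega⟩) := by
  rw [totalScore, sum_rotationProfile hmk T M fun p => s (p x)]
  simp only [topRanking_of_le hmk _ h, bottomRanking_of_le hmk _ h]
  simp
  ring

theorem le_topSupporters_rotationProfile {m k : ℕ} [NeZero k] (hmk : k < m) (T M : ℕ) :
    (k * T : ℝ) ≤ topSupporters (rotationProfile hmk T M)
      (Finset.univ.filter fun x : Fin m => (x : ℕ) < k) := by
  set F : (Fin m ≃ Fin m) → ℝ := fun p =>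
    if ∀ a ∈ Finset.univ.filter fun x : Fin m => (x : ℕ) < k,
      ∀ b ∉ Finset.univ.filter fun x : Fin m => (x : ℕ) < k, p a < p b then 1 else 0
    with hF
  have hcard : (topSupporters (rotationProfile hmk T M)
      (Finset.univ.filter fun x : Fin m => (x : ℕ) < k) : ℝ) =
      ∑ i, F (rotationProfile hmk T M i) := by
    rw [topSupporters, Finset.card_filter]
    push_cast
    rfl
  have htop : ∀ σ, F (topRanking hmk σ) = 1 := fun σ => if_pos <| by
    intro a ha b hb
    simp only [Finset.mem_filter, Finset.mem_univ, true_and, not_lt] at ha hb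
    rw [topRanking_of_lt hmk σ ha, topRanking_of_le hmk σ hb, Fin.lt_def]
    exact (σ ⟨a, ha⟩).2.trans_le hb
  have hbot : ∀ σ, 0 ≤ F (bottomRanking hmk σ) := fun σ => by
    simp only [hF]
    split_ifs <;> norm_num
  rw [hcard, sum_rotationProfile]
  simp only [htop]
  have := mul_nonneg (Nat.cast_nonneg (α := ℝ) M) 
    (Finset.sum_nonneg (s := (Finset.univ : Finset (Fin k)))
      fun j _ => hbot (Equiv.addRight j))
  simp only [Finset.sum_const, Finset.card_univ, Fintype.card_fin, nsmul_eq_mul, mul_one]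
  linarith

theorem mem_scoringWinners_rotationProfile {m k : ℕ} [NeZero k] (hmk : k < m) (T M : ℕ) (s : Fin m → ℝ)
    (hmono : Antitone s)
    (h : (T : ℝ) * ∑ i : Fin k, s ⟨(i : ℕ), i.2.trans hmk⟩ +
        M * ∑ i : Fin k, s ⟨m - 1 - (i : ℕ), sub_one_sub_lt hmk i⟩ ≤
      k * (T * s ⟨k, hmk⟩ + M * s ⟨0, k.zero_le.trans_lt hmk⟩)) :
    (⟨k, hmk⟩ : Fin m) ∈ scoringWinners (rotationProfile hmk T M) s := by
  refine Finset.mem_filter.2 ⟨Finset.mem_univ _, fun b => ?_⟩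
  rw [totalScore_rotationProfile_of_le hmk T M s (x := ⟨k, hmk⟩) le_rfl]
  simp only [Nat.sub_self]
  rcases lt_or_ge (b : ℕ) k with hb | hb
  · rwa [totalScore_rotationProfile_of_lt hmk T M s hb]
  · rw [totalScore_rotationProfile_of_le hmk T M s hb]
    have h₁ : s b ≤ s ⟨k, hmk⟩ := hmono (Fin.le_def.2 hb)
    have h₂ : s ⟨b - k, by omega⟩ ≤ s ⟨0, k.zero_le.trans_lt hmk⟩ := hmono (Fin.le_def.2 (Nat.zero_le _))
    gcongr

/-- For a monotonic scoring rule with scores `s_1 ≥ … ≥ s_m`, `s_1 > s_m`, for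
all `m > k ≥ 1` and every real `0 < q < 1`, the rule satisfies the
`(q,k,m)`-majority criterion iff
`q ≥ (s_1 − (1/k)·Σ_{i=1}^k s_{m−i+1}) /
  (s_1 − (1/k)·Σ_{i=1}^k s_{m−i+1} + (1/k)·Σ_{i=1}^k s_i − s_{k+1})`. -/
theorem scoring_qkm_majority (m k : ℕ) (hk : 1 ≤ k) (hmk : k < m)
    (s : Fin m → ℝ) (hmono : ∀ i j : Fin m, i ≤ j → s j ≤ s i)
    (hs : s ⟨m - 1, by omega⟩ < s ⟨0, by omega⟩)
    (q : ℝ) (hq0 : 0 < q) (hq1 : q < 1) :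
    MajorityCriterion m k q (fun n P => scoringWinners P s) ↔
      (s ⟨0, by omega⟩ - (1 / (k : ℝ)) * ∑ i : Fin k, s ⟨m - 1 - (i : ℕ), by omega⟩) /
        (s ⟨0, by omega⟩ - (1 / (k : ℝ)) * ∑ i : Fin k, s ⟨m - 1 - (i : ℕ), by omega⟩
          + (1 / (k : ℝ)) * ∑ i : Fin k, s ⟨(i : ℕ), by omega⟩ - s ⟨k, hmk⟩) ≤ q := by
  have : NeZero k := ⟨by omega⟩
  have hkR : (0 : ℝ) < k := by exact_mod_cast hk
  have hanti : Antitone s := fun i j hij => hmono i j hij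
  have hα : ∑ i : Fin k, s ⟨m - 1 - (i : ℕ), by omega⟩ < k * s ⟨0, by omega⟩ := by
    calc
      _ < ∑ _i : Fin k, s ⟨0, by omega⟩ :=
        Finset.sum_lt_sum (fun i _ => hmono _ _ (Fin.le_def.2 (Nat.zero_le _)))
          ⟨⟨0, hk⟩, Finset.mem_univ _, by simpa using hs⟩
      _ = _ := by simp
  have hβ : k * s ⟨k, hmk⟩ ≤ ∑ i : Fin k, s ⟨(i : ℕ), by omega⟩ := by
    calc
      _ = ∑ _i : Fin k, s ⟨k, hmk⟩ := by simp
      _ ≤ _ := Finset.sum_le_sum fun i _ => hmono _ _ (Fin.le_def.2 i.2.le)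
  have htop := fun n P B hB => @topSupporters_mul_le m k n hk hmk s hanti P B hB
  have hrot := fun T M => mem_scoringWinners_rotationProfile hmk T M s hanti
  set top : ℝ := ∑ i : Fin k, s ⟨(i : ℕ), by omega⟩
  set bot : ℝ := ∑ i : Fin k, s ⟨m - 1 - (i : ℕ), by omega⟩
  set s₀ := s ⟨0, by omega⟩
  set sk := s ⟨k, hmk⟩
  have hratio : (s₀ - 1 / (k : ℝ) * bot) / (s₀ - 1 / (k : ℝ) * bot + 1 / (k : ℝ) * top - sk) =
      (k * s₀ - bot) / (k * s₀ - bot + top - k * sk) := by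
    rw [← mul_div_mul_left _ _ hkR.ne']
    congr 1 <;> field_simp
  have hden : 0 < k * s₀ - bot + top - k * sk := by linarith
  rw [hratio]
  constructor
  · intro hcrit
    by_contra! hlt
    obtain ⟨r, hqr, hr⟩ := exists_rat_btwn hlt
    have hr0 : 0 < r := by exact_mod_cast hq0.trans hqr
    have hr1 : (r : ℝ) ≤ 1 := hr.le.trans ((div_le_one hden).2 (by linarith))
    have hdenR : (0 : ℝ) < r.den := by exact_mod_cast r.den_pos
    obtain ⟨T, hT⟩ := Int.eq_ofNat_of_zero_le (Rat.num_pos.2 hr0).le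
    have hrT : (r : ℝ) * r.den = T := by
      have h : (r : ℚ) * r.den = T := by rw [Rat.mul_den_eq_num, hT]; rfl
      exact_mod_cast h
    have hTden : T ≤ r.den := by
      have : (T : ℝ) ≤ r.den := by rw [← hrT]; nlinarith
      exact_mod_cast this
    obtain ⟨M, hM⟩ := Nat.exists_eq_add_of_le hTden
    have hMR : (r.den : ℝ) = T + M := by exact_mod_cast hM
    have hwin := hrot T M (by
      have h₁ := (lt_div_iff₀ hden).1 hr
      have h₂ : (T : ℝ) * (k * s₀ - bot + top - k * sk) ≤ (T + M) * (k * s₀ - bot) := by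
        rw [← hMR, ← hrT]
        nlinarith
      linarith)
    have hmem := hcrit _ (Nat.mul_pos hk (hM ▸ r.den_pos)) (rotationProfile hmk T M)
      (Finset.univ.filter fun x : Fin m => (x : ℕ) < k)
      (by simp [Fin.card_filter_val_lt, hmk.le])
      (lt_of_lt_of_le (by
        push_cast
        rw [← hMR, ← hrT]
        have := mul_lt_mul_of_pos_right hqr (mul_pos hkR hdenR)
        linarith) (le_topSupporters_rotationProfile hmk T M)) hwin
    simp at hmem
  · intro hle n hn P B hB hT a ha
    by_contra haB
    have h := htop n P B hB ha haB
    have hnR : (0 : ℝ) < n := by exact_mod_cast hn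
    have h₁ := (div_le_iff₀ hden).1 hle
    have h₂ := mul_lt_mul_of_pos_right hT hden
    have h₃ := mul_le_mul_of_nonneg_left h₁ hnR.le
    linarith

end Voting
end
end

section
/- Let s_1 ≥ s_2 ≥ … ≥ s_m be real scores with s_1 > s_m defining a monotonic scoring rule, where m > 1. The scoring rule satisfies the majority loser criterion if and only if s_1 − (s_2 + … + s_m)/(m−1) ≤ (s_1 + … + s_{m−1})/(m−1) − s_m. -/
open Finset
open scoped Classical

noncomputable section

namespace Voting

variable {m n : ℕ}

theorem lastCount_eq_card_last {d n : ℕ} (P : Profile (d + 1) n) (a : Fin (d + 1)) :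
    lastCount P a = (Finset.univ.filter fun i => P i a = Fin.last d).card := by
  unfold lastCount
  congr 1
  ext i
  simp only [Finset.mem_filter, Finset.mem_univ, true_and]
  constructor
  · intro h
    by_contra hne
    have hb : (P i).symm (Fin.last d) ≠ a := by
      rintro rfl
      simp at hne
    have hlt := h _ hb
    rw [Equiv.apply_symm_apply] at hlt
    exact absurd (Fin.le_last (P i a)) (not_le.mpr hlt)
  · intro h b hb
    rw [h]
    exact Fin.lt_last_iff_ne_last.mpr fun hl => hb ((P i).injective (hl.trans h.symm))

/-- The scores of all candidates together amount to the sum of the scoring vector per voter. -/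
theorem sum_scores {V : Type*} [Fintype V] {m : ℕ} (P : V → (Fin m ≃ Fin m)) (s : Fin m → ℝ) :
    ∑ b, ∑ v, s (P v b) = (Fintype.card V : ℝ) * ∑ j, s j := by
  rw [Finset.sum_comm]
  simp [Equiv.sum_comp]

/-- The majority loser criterion, for voters indexed by an arbitrary finite type. -/
theorem exists_score_lt_of_majority_loser {d : ℕ} {s : Fin (d + 1) → ℝ}
    (H : ∀ n : ℕ, 1 ≤ n → ∀ P : Profile (d + 1) n, ∀ a : Fin (d + 1),
      (n : ℝ) / 2 < (lastCount P a : ℝ) → a ∉ scoringWinners P s)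
    {V : Type*} [Fintype V] [Nonempty V] (P : V → (Fin (d + 1) ≃ Fin (d + 1))) (a : Fin (d + 1))
    (ha : Fintype.card V < 2 * (Finset.univ.filter fun v => P v a = Fin.last d).card) :
    ∃ b, ∑ v, s (P v a) < ∑ v, s (P v b) := by
  let e := (Fintype.equivFin V).symm
  have key := H (Fintype.card V) Fintype.card_pos (fun i => P (e i)) a ?_
  · simp only [scoringWinners, totalScore, Finset.mem_filter, Finset.mem_univ, true_and,
      not_forall, not_le] at key
    obtain ⟨b, hb⟩ := key
    rw [Equiv.sum_comp e fun v => s (P v a), Equiv.sum_comp e fun v => s (P v b)] at hb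
    exact ⟨b, hb⟩
  · have hcard : (Finset.univ.filter fun i => P (e i) a = Fin.last d).card =
        (Finset.univ.filter fun v => P v a = Fin.last d).card :=
      Finset.card_equiv e (by simp)
    rw [lastCount_eq_card_last, hcard, div_lt_iff₀ two_pos, mul_comm]
    exact_mod_cast ha

/-- A candidate placed last by all of `k + 1` blocks of voters and first by all of `k` blocks, each
block being symmetric in the other candidates, scores less than the average. -/
theorem block_score_lt_average {d : ℕ} {s : Fin (d + 1) → ℝ}
    (H : ∀ n : ℕ, 1 ≤ n → ∀ P : Profile (d + 1) n, ∀ a : Fin (d + 1),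
      (n : ℝ) / 2 < (lastCount P a : ℝ) → a ∉ scoringWinners P s) (k : ℕ) :
    ((d : ℝ) + 1) * ((k + 1) * s (Fin.last d) + k * s 0) < (2 * k + 1) * ∑ j, s j := by
  let G := {σ : Equiv.Perm (Fin (d + 1)) // σ 0 = 0}
  have : Nonempty G := ⟨⟨1, rfl⟩⟩
  let P : (Fin (k + 1) ⊕ Fin k) × G → (Fin (d + 1) ≃ Fin (d + 1)) := fun v =>
    v.2.1.trans (Sum.elim (fun _ => Equiv.swap 0 (Fin.last d)) (fun _ => Equiv.refl _) v.1)
  have hN : 0 < Fintype.card G := Fintype.card_pos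
  have hN' : (0 : ℝ) < Fintype.card G := by exact_mod_cast hN
  have hcard : Fintype.card ((Fin (k + 1) ⊕ Fin k) × G) = (2 * k + 1) * Fintype.card G := by
    simp only [Fintype.card_prod, Fintype.card_sum, Fintype.card_fin]
    ring
  have hlast : (k + 1) * Fintype.card G ≤
      (Finset.univ.filter fun v => P v 0 = Fin.last d).card := by
    have h : Fintype.card (Fin (k + 1) × G) = (k + 1) * Fintype.card G := by simp
    rw [← h, ← Finset.card_univ]
    refine Finset.card_le_card_of_injOn (fun v => (Sum.inl v.1, v.2)) ?_ ?_
    · rintro ⟨i, σ⟩ -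
      refine Finset.mem_coe.mpr (Finset.mem_filter.mpr ⟨Finset.mem_univ _, ?_⟩)
      simp [P, σ.2]
    · rintro ⟨i, σ⟩ - ⟨j, τ⟩ - h
      simpa using h
  obtain ⟨b, hb⟩ := exists_score_lt_of_majority_loser H P 0 (by rw [hcard]; nlinarith)
  have hb0 : b ≠ 0 := by
    rintro rfl
    exact lt_irrefl _ hb
  have hsymm : ∀ c, c ≠ 0 → ∑ v, s (P v c) = ∑ v, s (P v b) := by
    intro c hc
    have hfix : Equiv.swap b c 0 = 0 := Equiv.swap_apply_of_ne_of_ne hb0.symm hc.symm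
    let f : (Fin (k + 1) ⊕ Fin k) × G → (Fin (k + 1) ⊕ Fin k) × G := fun v =>
      (v.1, ⟨v.2.1 * Equiv.swap b c, by rw [Equiv.Perm.mul_apply, hfix, v.2.2]⟩)
    have hf : Function.Involutive f := by
      rintro ⟨i, σ, hσ⟩
      simp [f, mul_assoc]
    rw [← Equiv.sum_comp hf.toPerm]
    refine Finset.sum_congr rfl fun v _ => ?_
    simp [P, f]
  have hzero : ∑ v, s (P v 0) = Fintype.card G * ((k + 1) * s (Fin.last d) + k * s 0) := by
    rw [Fintype.sum_prod_type, Fintype.sum_sum_type]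
    have h1 : ∀ (i : Fin (k + 1)) (σ : G), P (Sum.inl i, σ) 0 = Fin.last d := by
      intro i σ
      simp [P, σ.2]
    have h2 : ∀ (i : Fin k) (σ : G), P (Sum.inr i, σ) 0 = 0 := by
      intro i σ
      simp [P, σ.2]
    simp only [h1, h2, Finset.sum_const, Finset.card_univ, Fintype.card_fin, nsmul_eq_mul]
    push_cast
    ring
  have htotal := sum_scores P s
  rw [Fin.sum_univ_succ, Finset.sum_congr rfl fun j _ => hsymm (Fin.succ j) (Fin.succ_ne_zero j),
    hcard] at htotal
  simp only [Finset.sum_const, Finset.card_univ, Fintype.card_fin, nsmul_eq_mul] at htotal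
  push_cast at htotal
  have hd : (0 : ℝ) < d := by
    rcases d with _ | d
    · exact absurd (Fin.fin_one_eq_zero b) hb0
    · positivity
  have hmul := mul_lt_mul_of_pos_left hb hd
  rw [hzero] at htotal hmul
  refine lt_of_mul_lt_mul_left ?_ hN'.le
  linarith

/-- If the extreme scores average to at most the mean score, a majority loser never wins. -/
theorem majority_loser_notMem_scoringWinners {d : ℕ} {s : Fin (d + 1) → ℝ}
    (hmono : ∀ i j : Fin (d + 1), i ≤ j → s j ≤ s i) (hs : s (Fin.last d) < s 0)
    (h : ((d : ℝ) + 1) * (s 0 + s (Fin.last d)) ≤ 2 * ∑ j, s j)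
    {n : ℕ} (P : Profile (d + 1) n) (a : Fin (d + 1))
    (ha : (n : ℝ) / 2 < (lastCount P a : ℝ)) : a ∉ scoringWinners P s := by
  intro hw
  simp only [scoringWinners, Finset.mem_filter, Finset.mem_univ, true_and] at hw
  have htotal := sum_scores P s
  rw [Fintype.card_fin] at htotal
  have hle : ∑ b, ∑ v, s (P v b) ≤ ((d : ℝ) + 1) * totalScore P s a := by
    refine (Finset.sum_le_sum fun b _ => hw b).trans ?_
    simp
  have hscore : totalScore P s a ≤ n * s 0 - lastCount P a * (s 0 - s (Fin.last d)) := by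
    calc totalScore P s a
        ≤ ∑ i, (s 0 - if P i a = Fin.last d then s 0 - s (Fin.last d) else 0) := by
          refine Finset.sum_le_sum fun i _ => ?_
          split_ifs with hi
          · rw [hi]
            linarith
          · simpa using hmono 0 (P i a) (Fin.zero_le _)
      _ = _ := by
          rw [Finset.sum_sub_distrib, ← Finset.sum_filter, lastCount_eq_card_last]
          simp [mul_sub]
  have hstrict : totalScore P s a < (n : ℝ) / 2 * (s 0 + s (Fin.last d)) := by
    nlinarith [mul_lt_mul_of_pos_right ha (sub_pos.mpr hs)]
  have hd : (0 : ℝ) < (d : ℝ) + 1 := by positivity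
  have h1 := mul_lt_mul_of_pos_left hstrict hd
  have h2 := mul_le_mul_of_nonneg_left h (by positivity : (0 : ℝ) ≤ (n : ℝ) / 2)
  linarith

/-- A monotonic scoring rule with scores `s_1 ≥ … ≥ s_m`, `s_1 > s_m`, `m > 1`,
satisfies the majority loser criterion iff
`s_1 − (s_2 + … + s_m)/(m−1) ≤ (s_1 + … + s_{m−1})/(m−1) − s_m`. -/
theorem scoring_majority_loser (m : ℕ) (hm : 1 < m)
    (s : Fin m → ℝ) (hmono : ∀ i j : Fin m, i ≤ j → s j ≤ s i)
    (hs : s ⟨m - 1, by omega⟩ < s ⟨0, by omega⟩) :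
    (∀ n : ℕ, 1 ≤ n → ∀ P : Profile m n, ∀ a : Fin m,
        (n : ℝ) / 2 < (lastCount P a : ℝ) → a ∉ scoringWinners P s) ↔
      s ⟨0, by omega⟩ - (∑ j : Fin (m - 1), s ⟨(j : ℕ) + 1, by omega⟩) / ((m : ℝ) - 1) ≤
        (∑ j : Fin (m - 1), s ⟨(j : ℕ), by omega⟩) / ((m : ℝ) - 1) - s ⟨m - 1, by omega⟩ := by
  obtain ⟨d, rfl⟩ : ∃ d, m = d + 1 := ⟨m - 1, by omega⟩
  have hd : (0 : ℝ) < d := by exact_mod_cast (by omega : 0 < d)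
  change s (Fin.last d) < s 0 at hs
  have hfirst : ∑ j, s j = s 0 + ∑ j : Fin d, s j.succ := Fin.sum_univ_succ s
  have hlast : ∑ j, s j = ∑ j : Fin d, s j.castSucc + s (Fin.last d) := Fin.sum_univ_castSucc s
  change _ ↔ s 0 - (∑ j : Fin d, s j.succ) / (((d + 1 : ℕ) : ℝ) - 1) ≤
    (∑ j : Fin d, s j.castSucc) / (((d + 1 : ℕ) : ℝ) - 1) - s (Fin.last d)
  have hiff : (s 0 - (∑ j : Fin d, s j.succ) / (((d + 1 : ℕ) : ℝ) - 1) ≤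
      (∑ j : Fin d, s j.castSucc) / (((d + 1 : ℕ) : ℝ) - 1) - s (Fin.last d)) ↔
      ((d : ℝ) + 1) * (s 0 + s (Fin.last d)) ≤ 2 * ∑ j, s j := by
    have hS : ∑ j : Fin d, s j.succ = ∑ j, s j - s 0 := by linarith
    have hL : ∑ j : Fin d, s j.castSucc = ∑ j, s j - s (Fin.last d) := by linarith
    rw [hS, hL, Nat.cast_add_one, add_sub_cancel_right, sub_div' hd.ne', div_sub' hd.ne',
      div_le_div_iff_of_pos_right hd]
    constructor <;> intro h <;> linarith
  rw [hiff]
  constructor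
  · intro H
    by_contra! hlt
    obtain ⟨k, hk⟩ := exists_nat_gt ((∑ j, s j - (d + 1) * s (Fin.last d)) /
      ((d + 1) * (s 0 + s (Fin.last d)) - 2 * ∑ j, s j))
    rw [div_lt_iff₀ (sub_pos.mpr hlt)] at hk
    linarith [block_score_lt_average H k]
  · intro h n _ P a ha
    exact majority_loser_notMem_scoringWinners hmono hs h P a ha

end Voting
end
end

section
/- For all integers m and k with m−1 > k ≥ 1 and every real number q with 0 < q < 1, the inverse plurality rule fails the (q,k,m)-majority criterion. -/
open Finset
open scoped Classical

noncomputable section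

namespace Voting

variable {m n : ℕ}

/-- The inverse plurality rule: the winners are the candidates minimizing
`n_m`, the number of voters ranking them last. -/
def inversePluralityWinners (P : Profile m n) : Finset (Fin m) :=
  Finset.univ.filter fun a => ∀ b, lastCount P a ≤ lastCount P b

/-- For all integers `m − 1 > k ≥ 1` and every real `0 < q < 1`, the inverse
plurality rule fails the `(q,k,m)`-majority criterion. -/
theorem inverse_plurality_qkm_majority_fails (m k : ℕ) (hk : 1 ≤ k)
    (hm : k + 1 < m) (q : ℝ) (hq0 : 0 < q) (hq1 : q < 1) :
    ¬ MajorityCriterion m k q (fun n P => inversePluralityWinners P) := by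
  intro h
  set c : Fin m := ⟨k, by omega⟩ with hc
  have hwin : c ∈ inversePluralityWinners (fun _ : Fin 1 => Equiv.refl (Fin m)) := by
    have hlast : lastCount (fun _ : Fin 1 => Equiv.refl (Fin m)) c = 0 := by
      refine Finset.card_eq_zero.mpr (Finset.filter_eq_empty_iff.mpr fun _ _ hmax => ?_)
      have hlt := hmax ⟨k + 1, hm⟩ (by simp [hc])
      simp [hc, Fin.lt_def] at hlt
    simp [inversePluralityWinners, hlast]
  have htop : topSupporters (fun _ : Fin 1 => Equiv.refl (Fin m)) (Finset.Iio c) = 1 := by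
    rw [topSupporters, Finset.filter_true_of_mem, Finset.card_univ, Fintype.card_fin]
    intro _ _ a ha b hb
    exact (Finset.mem_Iio.mp ha).trans_le (not_lt.mp (mt Finset.mem_Iio.mpr hb))
  have hsub := h 1 le_rfl (fun _ => Equiv.refl (Fin m)) (Finset.Iio c) (by simp [hc])
    (by rw [htop]; simpa using hq1)
  exact lt_irrefl c (Finset.mem_Iio.mp (hsub hwin))

end Voting
end
end

section
/- For all integers k ≥ 1 and m = k+1, and every real number q with 0 < q < 1, the inverse plurality rule satisfies the (q,k,m)-majority criterion if and only if q ≥ 1/m. -/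
open Finset
open scoped Classical

noncomputable section

namespace Voting

variable {m n : ℕ}

theorem forall_ne_lt_iff_eq_last {k : ℕ} (e : Fin (k + 1) ≃ Fin (k + 1)) (a : Fin (k + 1)) :
    (∀ b, b ≠ a → e b < e a) ↔ e a = Fin.last k := by
  constructor
  · intro h
    by_contra hne
    have hb : e.symm (Fin.last k) ≠ a := by
      rintro rfl
      exact hne (e.apply_symm_apply _)
    have hlt := h _ hb
    rw [e.apply_symm_apply] at hlt
    exact absurd hlt (not_lt.mpr (Fin.le_last _))
  · intro h b hb
    rw [h]
    refine lt_of_le_of_ne (Fin.le_last _) fun hlast => hb (e.injective ?_)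
    rw [hlast, h]

theorem lastCount_eq_card {k n : ℕ} (P : Profile (k + 1) n) (a : Fin (k + 1)) :
    lastCount P a = (Finset.univ.filter fun i => (P i).symm (Fin.last k) = a).card := by
  unfold lastCount
  congr 1
  ext i
  simp only [Finset.mem_filter, Finset.mem_univ, true_and]
  rw [forall_ne_lt_iff_eq_last, Equiv.symm_apply_eq, eq_comm]

theorem sum_lastCount {k n : ℕ} (P : Profile (k + 1) n) : ∑ a, lastCount P a = n := by
  have h := Finset.card_eq_sum_card_fiberwise (s := (Finset.univ : Finset (Fin n)))
    (t := (Finset.univ : Finset (Fin (k + 1))))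
    (f := fun i => (P i).symm (Fin.last k)) (fun _ _ => Finset.mem_coe.mpr (Finset.mem_univ _))
  rw [Finset.card_univ, Fintype.card_fin] at h
  exact (Finset.sum_congr rfl fun a _ => lastCount_eq_card P a).trans h.symm

theorem topSupporters_compl_singleton (P : Profile m n) (c : Fin m) :
    topSupporters P {c}ᶜ = lastCount P c := by
  unfold topSupporters lastCount
  congr 1
  ext i
  simp

/-- For all integers `k ≥ 1` and `m = k + 1`, and every real `0 < q < 1`, the
inverse plurality rule satisfies the `(q,k,m)`-majority criterion iff
`q ≥ 1/m`. -/
theorem inverse_plurality_qkm_majority_top (m k : ℕ) (hk : 1 ≤ k)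
    (hm : m = k + 1) (q : ℝ) (hq0 : 0 < q) (hq1 : q < 1) :
    MajorityCriterion m k q (fun n P => inversePluralityWinners P) ↔
      (1 : ℝ) / (m : ℝ) ≤ q := by
  subst hm
  have hpos : (0 : ℝ) < ((k + 1 : ℕ) : ℝ) := by positivity
  constructor
  · intro h
    by_contra! hq
    let P : Profile (k + 1) (k + 1) := fun i => Equiv.swap i (Fin.last k)
    have hP : ∀ a, lastCount P a = 1 := by
      intro a
      rw [lastCount_eq_card]
      simp [P, Finset.filter_eq']
    have hsub := h (k + 1) (Nat.succ_pos k) P {0}ᶜ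
      (by rw [Finset.card_compl, Fintype.card_fin, Finset.card_singleton, Nat.add_sub_cancel])
      (by
        rw [topSupporters_compl_singleton, hP, Nat.cast_one]
        exact (lt_div_iff₀ hpos).mp hq)
    have hmem : (0 : Fin (k + 1)) ∈ inversePluralityWinners P := by
      simp [inversePluralityWinners, hP]
    exact absurd (hsub hmem) (by simp)
  · intro hq n _ P B hB hsupp
    obtain ⟨c, hc⟩ : ∃ c, Bᶜ = {c} := by
      rw [← Finset.card_eq_one, Finset.card_compl, Fintype.card_fin, hB, Nat.add_sub_cancel_left]
    obtain rfl : B = {c}ᶜ := by rw [← hc, compl_compl]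
    rw [topSupporters_compl_singleton] at hsupp
    intro a ha
    rw [Finset.mem_compl, Finset.mem_singleton]
    rintro rfl
    have hmin : ∀ b, lastCount P a ≤ lastCount P b := (Finset.mem_filter.mp ha).2
    have hle : (k + 1) * lastCount P a ≤ n := by
      calc (k + 1) * lastCount P a = ∑ _b : Fin (k + 1), lastCount P a := by simp
        _ ≤ ∑ b, lastCount P b := Finset.sum_le_sum fun b _ => hmin b
        _ = n := sum_lastCount P
    have hle' : ((k + 1 : ℕ) : ℝ) * (lastCount P a : ℝ) ≤ n := by exact_mod_cast hle
    have hmq : 1 ≤ q * ((k + 1 : ℕ) : ℝ) := (div_le_iff₀ hpos).mp hq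
    have hn : (0 : ℝ) ≤ n := Nat.cast_nonneg n
    have hstrict := mul_lt_mul_of_pos_left hsupp hpos
    have hscale := mul_le_mul_of_nonneg_right hmq hn
    linarith

end Voting
end
end

section
/- For every integer k ≥ 1 and every real number q with 2k/(3k+1) ≤ q < 1, there exists a universal voting rule that satisfies both the second-order positional dominance criterion and the (q,k)-majority criterion. -/
open Finset
open scoped Classical

noncomputable section

namespace Voting

variable {m n : ℕ}

/-- A voting rule defined for every number of candidates and voters. -/
abbrev Rule := (m n : ℕ) → Profile m n → Finset (Fin m)

/-- A universal voting rule returns a nonempty choice set on every problem. -/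
def Universal (C : Rule) : Prop :=
  ∀ m n : ℕ, 1 ≤ m → 1 ≤ n → ∀ P : Profile m n, (C m n P).Nonempty

/-- A convex scoring vector: the differences of consecutive scores are positive
and nondecreasing from the bottom position to the top:
`0 < s_{m−1} − s_m ≤ s_{m−2} − s_{m−1} ≤ … ≤ s_1 − s_2`. -/
def ConvexScores {m : ℕ} (s : Fin m → ℝ) : Prop :=
  (∀ (j : ℕ) (h : j + 1 < m), 0 < s ⟨j, by omega⟩ - s ⟨j + 1, h⟩) ∧
  (∀ (j : ℕ) (h : j + 2 < m),
    s ⟨j + 1, by omega⟩ - s ⟨j + 2, h⟩ ≤ s ⟨j, by omega⟩ - s ⟨j + 1, by omega⟩)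

/-- The second-order positional dominance (2-PD) criterion: whenever `a` gets a
strictly higher total score than `b` under every convex scoring rule, `b` is
not a winner. -/
def SecondOrderPD (C : Rule) : Prop :=
  ∀ (m n : ℕ) (P : Profile m n) (a b : Fin m),
    (∀ s : Fin m → ℝ, ConvexScores s → totalScore P s b < totalScore P s a) →
    b ∉ C m n P

/-- The `(q,k)`-majority criterion for a universal rule: the `(q,k,m)`-majority
criterion holds for every total number of candidates `m > k`. -/
def RuleMajority (C : Rule) (q : ℝ) (k : ℕ) : Prop :=
  ∀ m : ℕ, k < m → ∀ n : ℕ, 1 ≤ n → ∀ P : Profile m n, ∀ B : Finset (Fin m),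
    B.card = k → q * (n : ℝ) < (topSupporters P B : ℝ) → C m n P ⊆ B

/-- The total number of points when each voter gives `k - r` points to rank `r` (none from
rank `k` on). -/
def truncatedScore (P : Profile m n) (k : ℕ) (a : Fin m) : ℕ :=
  ∑ i, (k - (P i a : ℕ))

/-- Truncated linear scores, refined by the Borda scores with a weight too small to reverse
a strict comparison among `n` voters. -/
def refinedScores (m n k : ℕ) (j : Fin m) : ℝ :=
  (((k - (j : ℕ)) * (n * m + 1) + (m - (j : ℕ)) : ℕ) : ℝ)

lemma convexScores_refinedScores (m n k : ℕ) : ConvexScores (refinedScores m n k) := by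
  constructor
  · intro j h
    rw [sub_pos]
    unfold refinedScores
    norm_cast
    have h1 : (k - (j + 1)) * (n * m + 1) ≤ (k - j) * (n * m + 1) :=
      Nat.mul_le_mul_right _ (by omega)
    dsimp only
    omega
  · intro j h
    have h1 : ((k - (j + 1) : ℕ) : ℝ) * 2 ≤ ((k - j : ℕ) : ℝ) + ((k - (j + 2) : ℕ) : ℝ) := by
      norm_cast
      omega
    have h2 : ((m - (j + 1) : ℕ) : ℝ) * 2 = ((m - j : ℕ) : ℝ) + ((m - (j + 2) : ℕ) : ℝ) := by
      norm_cast
      omega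
    have h3 : (0 : ℝ) ≤ n * m + 1 := by positivity
    have h4 := mul_le_mul_of_nonneg_right h1 h3
    unfold refinedScores
    push_cast
    linarith

lemma totalScore_refinedScores (P : Profile m n) (k : ℕ) (a : Fin m) :
    totalScore P (refinedScores m n k) a =
      ((truncatedScore P k a * (n * m + 1) + ∑ i, (m - (P i a : ℕ)) : ℕ) : ℝ) := by
  unfold totalScore refinedScores truncatedScore
  rw [← Nat.cast_sum, Finset.sum_add_distrib, Finset.sum_mul]

lemma totalScore_refinedScores_lt (P : Profile m n) {k : ℕ} {a b : Fin m}
    (h : truncatedScore P k b < truncatedScore P k a) :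
    totalScore P (refinedScores m n k) b < totalScore P (refinedScores m n k) a := by
  rw [totalScore_refinedScores, totalScore_refinedScores, Nat.cast_lt]
  have h1 : ∑ i, (m - (P i b : ℕ)) ≤ n * m := by
    calc ∑ i, (m - (P i b : ℕ)) ≤ ∑ _i : Fin n, m := Finset.sum_le_sum fun i _ => by omega
      _ = n * m := by simp
  have h2 := Nat.mul_le_mul_right (n * m + 1) (Nat.succ_le_of_lt h)
  rw [Nat.succ_mul] at h2
  omega

lemma scoringWinners_nonempty (hm : 1 ≤ m) (P : Profile m n) (s : Fin m → ℝ) :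
    (scoringWinners P s).Nonempty := by
  have : NeZero m := ⟨by omega⟩
  obtain ⟨a, ha⟩ := Finite.exists_max (totalScore P s)
  exact ⟨a, by simpa [scoringWinners] using ha⟩

lemma rank_lt_card_of_top (e : Fin m ≃ Fin m) {B : Finset (Fin m)}
    (h : ∀ a ∈ B, ∀ b ∉ B, e a < e b) {a : Fin m} (ha : a ∈ B) : (e a : ℕ) < B.card := by
  have hsub : (Finset.Iic (e a)).map e.symm.toEmbedding ⊆ B := by
    intro c hc
    by_contra hcB
    obtain ⟨r, hr, rfl⟩ := Finset.mem_map.1 hc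
    have := h a ha _ hcB
    simp at hr this
    exact absurd this (not_lt.2 hr)
  have := Finset.card_le_card hsub
  simp at this
  omega

lemma card_le_rank_of_top (e : Fin m ≃ Fin m) {B : Finset (Fin m)}
    (h : ∀ a ∈ B, ∀ b ∉ B, e a < e b) {c : Fin m} (hc : c ∉ B) : B.card ≤ (e c : ℕ) := by
  have hsub : B.map e.toEmbedding ⊆ Finset.Iio (e c) := by
    intro r hr
    obtain ⟨a, ha, rfl⟩ := Finset.mem_map.1 hr
    simpa using h a ha c hc
  simpa using Finset.card_le_card hsub

lemma two_mul_sum_truncated_of_top (e : Fin m ≃ Fin m) {B : Finset (Fin m)}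
    (h : ∀ a ∈ B, ∀ b ∉ B, e a < e b) :
    2 * ∑ a ∈ B, (B.card - (e a : ℕ)) = B.card * (B.card + 1) := by
  have hinj : Set.InjOn (fun a => (e a : ℕ)) (B : Set (Fin m)) :=
    fun a _ b _ hab => e.injective (Fin.ext hab)
  have himg : B.image (fun a => (e a : ℕ)) = Finset.range B.card := by
    apply Finset.eq_of_subset_of_card_le
    · intro r hr
      obtain ⟨a, ha, rfl⟩ := Finset.mem_image.1 hr
      exact Finset.mem_range.2 (rank_lt_card_of_top e h ha)
    · rw [Finset.card_image_of_injOn hinj, Finset.card_range]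
  rw [← Finset.sum_image (f := fun r => B.card - r) hinj, himg]
  generalize B.card = k
  have h1 : ∑ r ∈ Finset.range k, (k - r) = ∑ r ∈ Finset.range (k + 1), r := by
    rw [Finset.sum_range_succ', add_zero, ← Finset.sum_range_reflect]
    refine Finset.sum_congr rfl fun r hr => ?_
    have := Finset.mem_range.1 hr
    omega
  rw [h1, mul_comm, Finset.sum_range_id_mul_two, Nat.add_sub_cancel, mul_comm]

lemma topSupporters_mul_le_sum_truncatedScore (P : Profile m n) (B : Finset (Fin m)) :
    topSupporters P B * (B.card * (B.card + 1)) ≤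
      2 * ∑ a ∈ B, truncatedScore P B.card a := by
  unfold truncatedScore topSupporters
  rw [Finset.sum_comm, Finset.mul_sum, ← smul_eq_mul, ← Finset.sum_const, Finset.sum_filter]
  refine Finset.sum_le_sum fun i _ => ?_
  split_ifs with hi
  · exact (two_mul_sum_truncated_of_top (P i) hi).ge
  · exact Nat.zero_le _

lemma truncatedScore_add_le (P : Profile m n) {B : Finset (Fin m)} {c : Fin m} (hc : c ∉ B) :
    truncatedScore P B.card c + topSupporters P B * B.card ≤ n * B.card := by
  unfold truncatedScore topSupporters
  rw [← smul_eq_mul (_ : ℕ) B.card, ← Finset.sum_const, Finset.sum_filter,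
    ← Finset.sum_add_distrib]
  calc _ ≤ ∑ _i : Fin n, B.card := by
        refine Finset.sum_le_sum fun i _ => ?_
        split_ifs with hi
        · have := card_le_rank_of_top (P i) hi hc
          omega
        · omega
    _ = n * B.card := by simp

lemma exists_mem_truncatedScore_lt (P : Profile m n) {B : Finset (Fin m)}
    (hpos : 0 < B.card) (hB : 2 * B.card * n < (3 * B.card + 1) * topSupporters P B) {c : Fin m} (hc : c ∉ B) :
    ∃ a ∈ B, truncatedScore P B.card c < truncatedScore P B.card a := by
  by_contra! hle
  have h1 := topSupporters_mul_le_sum_truncatedScore P B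
  have h2 := Finset.sum_le_card_nsmul B _ _ hle
  have h3 := truncatedScore_add_le P hc
  rw [smul_eq_mul] at h2
  nlinarith

/-- For every integer `k ≥ 1` and every real `q` with `2k/(3k+1) ≤ q < 1`,
there exists a universal voting rule satisfying both the second-order
positional dominance criterion and the `(q,k)`-majority criterion. -/
theorem exists_2PD_and_qk_majority (k : ℕ) (hk : 1 ≤ k) (q : ℝ)
    (hq : 2 * (k : ℝ) / (3 * (k : ℝ) + 1) ≤ q) (hq1 : q < 1) :
    ∃ C : Rule, Universal C ∧ SecondOrderPD C ∧ RuleMajority C q k := by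
  refine ⟨fun m n P => scoringWinners P (refinedScores m n k), ?_, ?_, ?_⟩
  · exact fun m n hm _ P => scoringWinners_nonempty hm P _
  · intro m n P a b hab hb
    exact (hab _ (convexScores_refinedScores m n k)).not_ge ((Finset.mem_filter.1 hb).2 a)
  · intro m _ n _ P B hB hsup c hc
    by_contra hcB
    subst hB
    have hpos : (0 : ℝ) < 3 * (B.card : ℝ) + 1 := by positivity
    have hmaj : 2 * B.card * n < (3 * B.card + 1) * topSupporters P B := by
      have h := (mul_le_mul_of_nonneg_right hq (Nat.cast_nonneg n)).trans_lt hsup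
      rw [div_mul_eq_mul_div, div_lt_iff₀ hpos] at h
      rw [mul_comm (3 * B.card + 1)]
      exact_mod_cast h
    obtain ⟨a, -, ha⟩ := exists_mem_truncatedScore_lt P hk hmaj hcB
    exact (totalScore_refinedScores_lt P ha).not_ge ((Finset.mem_filter.1 hc).2 a)

end Voting
end
end
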